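/- Let k ≥ 2 be an integer, let M = ℤ/2kℤ, and let d be the shortest-path metric of the cycle C_{2k} on M, i.e., d(i,j) is the graph distance in the cycle in which i and j are adjacent if and only if i − j = ±1; the terminals are the k vertices with even representatives. Let T be any simple graph on the vertex set M that is a tree (connected and acyclic), and define the tree distance d_T(u,v) as the minimum, over all walks in T from u to v, of the sum of d(a,b) over the consecutive pairs {a,b} of the walk (equivalently, the sum of d along the unique simple T-path from u to v). Then there exist a terminal v (with even representative) and a vertex u ≠ v such that d_T(v,u) ≥ (2k−1)·d(v,u). -/

import Mathlib

/-- The cycle graph on `ℤ/2kℤ`: `i` and `j` are adjacent iff `i - j = ±1`. -/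
def cycleGraph (k : ℕ) : SimpleGraph (ZMod (2 * k)) :=
  SimpleGraph.fromRel (fun i j => i - j = 1)

/-- The shortest-path metric of the cycle `C_{2k}`, as a weight function on unordered
pairs of vertices. -/
noncomputable def cycW (k : ℕ) : Sym2 (ZMod (2 * k)) → ℝ :=
  Sym2.lift ⟨fun a b => ((cycleGraph k).dist a b : ℝ), fun a b => by
    show ((cycleGraph k).dist a b : ℝ) = ((cycleGraph k).dist b a : ℝ)
    rw [SimpleGraph.dist_comm]⟩

/-- The tree distance: the minimum over walks in `T` from `u` to `v` of the total weight
of the walk, where each edge `{a,b}` carries weight `w {a,b}`. -/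
noncomputable def wdist {V : Type} (T : SimpleGraph V) (w : Sym2 V → ℝ) (u v : V) : ℝ :=
  sInf {L : ℝ | ∃ p : T.Walk u v, L = (p.edges.map w).sum}

/-- On a tree, any assignment of increments to ordered pairs is realised, along each edge in at
least one of its two directions, by the differences of a potential. -/
theorem SimpleGraph.IsTree.exists_potential {V : Type*} {T : SimpleGraph V} (hT : T.IsTree)
    (f : V → V → ℤ) :
    ∃ φ : V → ℤ, ∀ a b, T.Adj a b → φ b = φ a + f a b ∨ φ a = φ b + f b a := by
  classical
  obtain ⟨r⟩ := hT.connected.nonempty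
  choose p hp using fun v => (hT.existsUnique_path r v).exists
  refine ⟨fun v => ((p v).darts.map fun d => f d.fst d.snd).sum, fun a b hab => ?_⟩
  by_cases hmem : a ∈ (p b).support
  · left
    have h := hT.isAcyclic.path_concat (hp a) (hp b) hab hmem
    simp [h, SimpleGraph.Walk.darts_concat]
  · right
    have h := (hT.existsUnique_path r a).unique (hp a) ((hp b).concat hmem hab.symm)
    simp [h, SimpleGraph.Walk.darts_concat]

theorem SimpleGraph.Connected.sub_eq_sub_of_adj {V A : Type*} [AddCommGroup A]
    {T : SimpleGraph V} (hT : T.Connected) {f g : V → A}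
    (h : ∀ a b, T.Adj a b → f b - f a = g b - g a) (u v : V) : f v - f u = g v - g u := by
  obtain ⟨p⟩ := hT u v
  induction p with
  | nil => simp
  | cons hadj _ ih => rw [← sub_add_sub_cancel, ih, h _ _ hadj, sub_add_sub_cancel]

theorem le_wdist {V : Type} {T : SimpleGraph V} (hT : T.Connected) {w : Sym2 V → ℝ} {φ : V → ℝ}
    (h : ∀ a b, T.Adj a b → |φ b - φ a| ≤ w s(a, b)) (u v : V) :
    |φ v - φ u| ≤ wdist T w u v := by
  obtain ⟨p⟩ := hT u v
  refine le_csInf ⟨_, p, rfl⟩ ?_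
  rintro _ ⟨q, rfl⟩
  induction q with
  | nil => simp
  | @cons a b c hadj q ih =>
    obtain ⟨p⟩ := hT b c
    have h₁ := h _ _ hadj
    have h₂ := ih p
    have h₃ := abs_sub_le (φ c) (φ b) (φ a)
    simp only [SimpleGraph.Walk.edges_cons, List.map_cons, List.sum_cons]
    linarith

theorem cycleGraph_adj_add_one {k : ℕ} (hk : 1 ≤ k) (i : ZMod (2 * k)) :
    (cycleGraph k).Adj i (i + 1) := by
  have : Fact (1 < 2 * k) := ⟨by omega⟩
  simp [cycleGraph]

theorem cycleGraph_connected {k : ℕ} (hk : 1 ≤ k) : (cycleGraph k).Connected := by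
  have : NeZero (2 * k) := ⟨by omega⟩
  have h : ∀ m : ℕ, (cycleGraph k).Reachable 0 (m : ZMod (2 * k)) := by
    intro m
    induction m with
    | zero => simp
    | succ m ih =>
      push_cast
      exact ih.trans (cycleGraph_adj_add_one hk _).reachable
  refine ⟨fun u v => ?_⟩
  rw [← ZMod.natCast_zmod_val u, ← ZMod.natCast_zmod_val v]
  exact (h _).symm.trans (h _)

theorem natAbs_valMinAbs_sub_le_dist {k : ℕ} (hk : 1 ≤ k) (a b : ZMod (2 * k)) :
    (b - a).valMinAbs.natAbs ≤ (cycleGraph k).dist a b := by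
  have : Fact (1 < 2 * k) := ⟨by omega⟩
  have hone : (1 : ZMod (2 * k)).valMinAbs.natAbs ≤ 1 := by
    rw [ZMod.valMinAbs_natAbs_eq_min, ZMod.val_one]
    exact min_le_left _ _
  obtain ⟨p, hp⟩ := (cycleGraph_connected hk).exists_walk_length_eq_dist a b
  rw [← hp]
  clear hp
  induction p with
  | nil => simp
  | @cons a b c hadj p ih =>
    have hstep : (b - a).valMinAbs.natAbs ≤ 1 := by
      rcases hadj.2 with h | h
      · rwa [← neg_sub, ZMod.natAbs_valMinAbs_neg, h]
      · rwa [h]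
    have h := (ZMod.natAbs_valMinAbs_add_le (c - b) (b - a)).trans (Int.natAbs_add_le _ _)
    rw [sub_add_sub_cancel] at h
    rw [SimpleGraph.Walk.length_cons]
    omega

/-- Every tree on `ℤ/2kℤ` stretches some pair of neighbours of the cycle to tree distance at
least `2k - 1`. -/
theorem exists_le_wdist_add_one {k : ℕ} (hk : 2 ≤ k) {T : SimpleGraph (ZMod (2 * k))}
    (hT : T.IsTree) :
    ∃ m < 2 * k, 2 * (k : ℝ) - 1 ≤ wdist T (cycW k) (m : ZMod (2 * k)) (m + 1) ∧
      2 * (k : ℝ) - 1 ≤ wdist T (cycW k) (m + 1) (m : ZMod (2 * k)) := by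
  obtain ⟨φ, hφ⟩ := hT.exists_potential fun a b => (b - a).valMinAbs
  have hcast : ∀ u v, (φ v : ZMod (2 * k)) - φ u = v - u :=
    hT.connected.sub_eq_sub_of_adj (f := fun v => (φ v : ZMod (2 * k))) (g := id) <| by
      intro a b hab
      rcases hφ a b hab with h | h <;> simp [h]
  have hle : ∀ a b, T.Adj a b → |(φ b : ℝ) - φ a| ≤ cycW k s(a, b) := by
    intro a b hab
    have key : (φ b - φ a).natAbs ≤ (cycleGraph k).dist a b := by
      rcases hφ a b hab with h | h
      · simpa [h] using natAbs_valMinAbs_sub_le_dist (by omega) a b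
      · rw [SimpleGraph.dist_comm, ← Int.natAbs_neg, neg_sub]
        simpa [h] using natAbs_valMinAbs_sub_le_dist (by omega) b a
    have : |φ b - φ a| ≤ ((cycleGraph k).dist a b : ℤ) := by
      rw [Int.abs_eq_natAbs]
      exact_mod_cast key
    change |(φ b : ℝ) - φ a| ≤ ((cycleGraph k).dist a b : ℝ)
    exact_mod_cast this
  have hw := le_wdist hT.connected (φ := fun v => (φ v : ℝ)) hle
  by_contra! hcon
  have hstep : ∀ m : ℕ, m < 2 * k → φ ((m : ZMod (2 * k)) + 1) = φ m + 1 := by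
    intro m hm
    have hlt : |(φ ((m : ZMod (2 * k)) + 1) : ℝ) - φ m| < 2 * (k : ℝ) - 1 := by
      by_cases h : 2 * (k : ℝ) - 1 ≤ wdist T (cycW k) (m : ZMod (2 * k)) (m + 1)
      · rw [abs_sub_comm]
        exact (hw _ _).trans_lt (hcon m hm h)
      · exact (hw _ _).trans_lt (not_le.mp h)
    have hlt' : |φ ((m : ZMod (2 * k)) + 1) - φ m| < 2 * (k : ℤ) - 1 := by exact_mod_cast hlt
    have hdvd : ((2 * k : ℕ) : ℤ) ∣ φ ((m : ZMod (2 * k)) + 1) - φ m - 1 := by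
      rw [← ZMod.intCast_zmod_eq_zero_iff_dvd]
      push_cast
      rw [hcast]
      ring
    have := Int.eq_zero_of_abs_lt_dvd hdvd (by push_cast; rw [abs_lt] at hlt' ⊢; omega)
    omega
  have hsum : ∀ m : ℕ, m ≤ 2 * k → φ (m : ZMod (2 * k)) = φ 0 + m := by
    intro m
    induction m with
    | zero => simp
    | succ m ih =>
      intro hm
      push_cast
      rw [hstep m (by omega), ih (by omega), add_assoc]
  have h := hsum (2 * k) le_rfl
  rw [ZMod.natCast_self] at h
  omega

/-- Metric lower bound: for the cycle metric on `ℤ/2kℤ` with the `k` alternating (even)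
points as terminals, every tree `T` on the point set (with edges weighted by the metric)
has a terminal `v` and a point `u ≠ v` with `d_T(v,u) ≥ (2k-1)·d(v,u)`. -/
theorem cycle_metric_tree_terminal_lower_bound (k : ℕ) (hk : 2 ≤ k)
    (T : SimpleGraph (ZMod (2 * k))) (hT : T.IsTree) :
    ∃ v u : ZMod (2 * k),
      (∃ j : ℕ, j < k ∧ v = ((2 * j : ℕ) : ZMod (2 * k))) ∧ u ≠ v ∧
      (2 * (k : ℝ) - 1) * ((cycleGraph k).dist v u : ℝ) ≤ wdist T (cycW k) v u := by
  obtain ⟨m, hm, h₁, h₂⟩ := exists_le_wdist_add_one hk hT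
  have hadj := cycleGraph_adj_add_one (by omega : 1 ≤ k) (m : ZMod (2 * k))
  have hdist : (cycleGraph k).dist (m : ZMod (2 * k)) (m + 1) = 1 :=
    SimpleGraph.dist_eq_one_iff_adj.mpr hadj
  rcases Nat.even_or_odd' m with ⟨j, hj | hj⟩
  · exact ⟨m, m + 1, ⟨j, by omega, by rw [hj]⟩, hadj.ne', by simpa [hdist] using h₁⟩
  · refine ⟨m + 1, m, ?_, hadj.ne, by simpa [SimpleGraph.dist_comm, hdist] using h₂⟩
    by_cases hjk : j + 1 < k
    · exact ⟨j + 1, hjk, by rw [hj]; push_cast; ring⟩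
    · refine ⟨0, by omega, ?_⟩
      rw [← Nat.cast_add_one, show m + 1 = 2 * k by omega]
      simp only [ZMod.natCast_self, Nat.mul_zero, Nat.cast_zero]
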